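/- For every natural number m and every ℓ > 0 there is a constant c > 0 such that for all r > 0, all t with 0 < t ≤ 1, and all Ω ∈ [9/10, 10/9], one has ∫₀^t ∫_{{p ∈ ℝ³ : |p| ≥ ℓ}} |p|^{−m} · e^{Ω⁻²·r·(t−s)}·κ_{r,Ω}(t−s; p, 0) · e^{Ω⁻²·r·s}·κ_{r,Ω}(s; 0, p) dp ds ≤ c·(1 + r²·t²)·e^{−1/(c·t)}. -/

import Mathlib

open MeasureTheory Real

/-- The (absolute value of the) Mehler-type heat kernel for the model operator in §4.2:
`κ_{r,Ω}(t;p₁,p₂) = (4π)^{-3/2} Ω t^{-1/2} exp(-Ω²(z₁-z₂)²/(4t)) ·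
  (r/sinh(Ω⁻²rt)) · exp(-(r/4) coth(Ω⁻²rt)((x₁-x₂)²+(y₁-y₂)²))`. -/
noncomputable def kappa (r t Ω : ℝ) (p₁ p₂ : EuclideanSpace ℝ (Fin 3)) : ℝ :=
  (4 * Real.pi) ^ (-(3:ℝ)/2) * Ω * t ^ (-(1:ℝ)/2) *
    Real.exp (-(Ω ^ 2 * (p₁ 2 - p₂ 2) ^ 2) / (4 * t)) *
    (r / Real.sinh ((Ω ^ 2)⁻¹ * r * t)) *
    Real.exp (-(r / 4) * (Real.cosh ((Ω ^ 2)⁻¹ * r * t) / Real.sinh ((Ω ^ 2)⁻¹ * r * t)) *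
      ((p₁ 0 - p₂ 0) ^ 2 + (p₁ 1 - p₂ 1) ^ 2))

theorem sinh_le_self_mul_cosh {u : ℝ} (hu : 0 ≤ u) : sinh u ≤ u * cosh u := by
  have hd : ∀ x : ℝ, HasDerivAt (fun x => x * cosh x - sinh x) (x * sinh x) x := fun x => by
    refine (((hasDerivAt_id x).mul (hasDerivAt_cosh x)).sub (hasDerivAt_sinh x)).congr_deriv ?_
    simp
  have hmono : MonotoneOn (fun x => x * cosh x - sinh x) (Set.Ici (0 : ℝ)) := by
    refine monotoneOn_of_deriv_nonneg (convex_Ici 0)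
      (fun x _ => (hd x).continuousAt.continuousWithinAt)
      (fun x _ => (hd x).differentiableAt.differentiableWithinAt) fun x hx => ?_
    rw [interior_Ici, Set.mem_Ioi] at hx
    rw [(hd x).deriv]
    exact mul_nonneg hx.le (sinh_nonneg_iff.2 hx.le)
  have h := hmono Set.self_mem_Ici hu hu
  simp only [zero_mul, sinh_zero, sub_zero] at h
  linarith

theorem exp_div_sinh_le {u : ℝ} (hu : 0 < u) : exp u / sinh u ≤ 2 + 1 / u := by
  have hs : 0 < sinh u := sinh_pos_iff.2 hu
  rw [div_le_iff₀ hs, show 2 + 1 / u = (2 * u + 1) / u by field_simp, div_mul_eq_mul_div,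
    le_div_iff₀ hu]
  have h1 : (1 + 2 * u) * exp (-u) ≤ exp u := by
    have : 2 * u + 1 ≤ exp (2 * u) := add_one_le_exp _
    calc (1 + 2 * u) * exp (-u) ≤ exp (2 * u) * exp (-u) := by gcongr; linarith
      _ = exp u := by rw [← exp_add]; ring_nf
  rw [sinh_eq]
  linarith

theorem kappa_nonneg {r s Ω : ℝ} (hr : 0 < r) (hs : 0 ≤ s) (hΩ : 0 ≤ Ω)
    (p q : EuclideanSpace ℝ (Fin 3)) : 0 ≤ kappa r s Ω p q := by
  have : 0 ≤ sinh ((Ω ^ 2)⁻¹ * r * s) := sinh_nonneg_iff.2 (by positivity)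
  unfold kappa
  positivity

theorem kappa_comm (r s Ω : ℝ) (p q : EuclideanSpace ℝ (Fin 3)) :
    kappa r s Ω p q = kappa r s Ω q p := by
  simp only [kappa, sub_sq_comm (p _) (q _)]

theorem kappa_zero_time (r Ω : ℝ) (p q : EuclideanSpace ℝ (Fin 3)) : kappa r 0 Ω p q = 0 := by
  simp [kappa]

theorem exp_neg_div_le {b s : ℝ} (hb : 0 < b) (hs : 0 < s) :
    1 / s ^ 2 * exp (-(b / s)) ≤ 2 / b ^ 2 := by
  have h := quadratic_le_exp_of_nonneg (x := b / s) (by positivity)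
  have h0 : 0 < b / s := by positivity
  have h1 : (b / s) ^ 2 / 2 ≤ exp (b / s) := by linarith
  rw [exp_neg, ← div_eq_mul_inv, div_le_iff₀ (exp_pos _)]
  calc 1 / s ^ 2 = 2 / b ^ 2 * ((b / s) ^ 2 / 2) := by field_simp
    _ ≤ _ := by gcongr

/-- Gaussian upper bound for the Mehler kernel, with the exponential prefactor absorbed. -/
theorem exp_mul_kappa_le {r s Ω : ℝ} (hr : 0 < r) (hs : 0 < s) (hs1 : s ≤ 1)
    (hΩ : Ω ∈ Set.Icc (9/10 : ℝ) (10/9)) (p : EuclideanSpace ℝ (Fin 3)) :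
    exp ((Ω ^ 2)⁻¹ * r * s) * kappa r s Ω p 0 ≤
      3 * (1 + r * s) * (1 / s ^ 2) * exp (-(‖p‖ ^ 2 / (5 * s))) := by
  obtain ⟨hΩ1, hΩ2⟩ := hΩ
  have hΩ0 : 0 < Ω := by linarith
  set u := (Ω ^ 2)⁻¹ * r * s with hu
  have hu0 : 0 < u := by positivity
  have hsinh : 0 < sinh u := sinh_pos_iff.2 hu0
  have hpref : exp u * (r / sinh u) ≤ 2 * (1 + r * s) / s := by
    have hΩs : Ω ^ 2 ≤ 2 := by nlinarith
    calc exp u * (r / sinh u) = r * (exp u / sinh u) := by ring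
      _ ≤ r * (2 + 1 / u) := by gcongr; exact exp_div_sinh_le hu0
      _ = (2 * (r * s) + Ω ^ 2) / s := by rw [hu]; field_simp
      _ ≤ _ := by gcongr; linarith
  have hcoth : Ω ^ 2 / s ≤ r * (cosh u / sinh u) := by
    have h := sinh_le_self_mul_cosh hu0.le
    have hr' : r = Ω ^ 2 / s * u := by rw [hu]; field_simp
    rw [hr', mul_assoc]
    refine le_mul_of_one_le_right (by positivity) ?_
    rw [← mul_div_assoc, one_le_div hsinh]
    exact h
  have hnorm : ‖p‖ ^ 2 = p 0 ^ 2 + p 1 ^ 2 + p 2 ^ 2 := by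
    rw [EuclideanSpace.real_norm_sq_eq, Fin.sum_univ_three]
  have hexp : exp (-(Ω ^ 2 * p 2 ^ 2) / (4 * s)) *
      exp (-(r / 4) * (cosh u / sinh u) * (p 0 ^ 2 + p 1 ^ 2)) ≤
      exp (-(‖p‖ ^ 2 / (5 * s))) := by
    rw [← exp_add]
    apply exp_le_exp.2
    have h1 : Ω ^ 2 / s * (p 0 ^ 2 + p 1 ^ 2) ≤
        r * (cosh u / sinh u) * (p 0 ^ 2 + p 1 ^ 2) := by gcongr
    have h2 : 4 / 5 * (‖p‖ ^ 2 / s) ≤ Ω ^ 2 * (‖p‖ ^ 2 / s) := by gcongr; nlinarith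
    have h3 : -(Ω ^ 2 * p 2 ^ 2) / (4 * s) = -(Ω ^ 2 / s * p 2 ^ 2) / 4 := by field_simp
    have h4 : ‖p‖ ^ 2 / (5 * s) = (4 / 5 * (‖p‖ ^ 2 / s)) / 4 := by field_simp
    have h5 : Ω ^ 2 * (‖p‖ ^ 2 / s) =
        Ω ^ 2 / s * (p 0 ^ 2 + p 1 ^ 2) + Ω ^ 2 / s * p 2 ^ 2 := by rw [hnorm]; ring
    rw [h3, h4]
    linarith
  have hpi : (4 * Real.pi) ^ (-(3:ℝ)/2) ≤ 1 :=
    rpow_le_one_of_one_le_of_nonpos (by linarith [pi_gt_three]) (by norm_num)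
  have hspow : s ^ (-(1:ℝ)/2) ≤ 1 / s := by
    rw [one_div, ← rpow_neg_one]
    exact rpow_le_rpow_of_exponent_ge hs hs1 (by norm_num)
  have hconst : (4 * Real.pi) ^ (-(3:ℝ)/2) * Ω * s ^ (-(1:ℝ)/2) ≤ 1 * (10 / 9) * (1 / s) := by
    gcongr
  calc exp u * kappa r s Ω p 0
      = ((4 * Real.pi) ^ (-(3:ℝ)/2) * Ω * s ^ (-(1:ℝ)/2)) * (exp u * (r / sinh u)) *
        (exp (-(Ω ^ 2 * p 2 ^ 2) / (4 * s)) *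
          exp (-(r / 4) * (cosh u / sinh u) * (p 0 ^ 2 + p 1 ^ 2))) := by
        simp only [kappa, PiLp.zero_apply, sub_zero]
        ring
    _ ≤ (1 * (10 / 9) * (1 / s)) * (2 * (1 + r * s) / s) * exp (-(‖p‖ ^ 2 / (5 * s))) := by
        gcongr
    _ = 20 / 9 * ((1 + r * s) * (1 / s ^ 2) * exp (-(‖p‖ ^ 2 / (5 * s)))) := by ring
    _ ≤ 3 * ((1 + r * s) * (1 / s ^ 2) * exp (-(‖p‖ ^ 2 / (5 * s)))) := by gcongr; norm_num
    _ = _ := by ring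

/-- Away from the diagonal the time singularity of the kernel is absorbed by half of the
Gaussian. -/
theorem exp_mul_kappa_le_of_le_norm {ℓ r s Ω : ℝ} (hℓ : 0 < ℓ) (hr : 0 < r) (hs : 0 < s)
    (hs1 : s ≤ 1) (hΩ : Ω ∈ Set.Icc (9/10 : ℝ) (10/9)) {p : EuclideanSpace ℝ (Fin 3)}
    (hp : ℓ ≤ ‖p‖) :
    exp ((Ω ^ 2)⁻¹ * r * s) * kappa r s Ω p 0 ≤
      600 / ℓ ^ 4 * (1 + r * s) * exp (-(‖p‖ ^ 2 / 10 / s)) := by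
  have hsing : 1 / s ^ 2 * exp (-(‖p‖ ^ 2 / 10 / s)) ≤ 200 / ℓ ^ 4 := by
    calc 1 / s ^ 2 * exp (-(‖p‖ ^ 2 / 10 / s)) ≤ 1 / s ^ 2 * exp (-(ℓ ^ 2 / 10 / s)) := by gcongr
      _ ≤ 2 / (ℓ ^ 2 / 10) ^ 2 := exp_neg_div_le (by positivity) hs
      _ = 200 / ℓ ^ 4 := by field_simp; norm_num
  calc exp ((Ω ^ 2)⁻¹ * r * s) * kappa r s Ω p 0
      ≤ 3 * (1 + r * s) * (1 / s ^ 2) * exp (-(‖p‖ ^ 2 / (5 * s))) :=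
        exp_mul_kappa_le hr hs hs1 hΩ p
    _ = 3 * (1 + r * s) * (1 / s ^ 2 * exp (-(‖p‖ ^ 2 / 10 / s))) *
          exp (-(‖p‖ ^ 2 / 10 / s)) := by
        rw [show -(‖p‖ ^ 2 / (5 * s)) = -(‖p‖ ^ 2 / 10 / s) + -(‖p‖ ^ 2 / 10 / s) by
          ring, exp_add]
        ring
    _ ≤ 3 * (1 + r * s) * (200 / ℓ ^ 4) * exp (-(‖p‖ ^ 2 / 10 / s)) := by gcongr
    _ = _ := by ring

theorem integrable_exp_neg_norm_sq :
    Integrable fun p : EuclideanSpace ℝ (Fin 3) => exp (-(‖p‖ ^ 2 / 10)) := by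
  refine (GaussianFourier.integrable_cexp_neg_mul_sq_norm_add (b := (1 / 10 : ℝ))
    (V := EuclideanSpace ℝ (Fin 3)) (by norm_num) 0 0).norm.congr (.of_forall fun p => ?_)
  have h : -((1 / 10 : ℝ) : ℂ) * (‖p‖ : ℂ) ^ 2 = ((-(‖p‖ ^ 2 / 10) : ℝ) : ℂ) := by
    push_cast
    ring
  simp only [zero_mul, add_zero]
  rw [h, Complex.norm_exp, Complex.ofReal_re]

/-- Pointwise bound for the integrand in the convolution of two kernels. -/
theorem kappa_convolution_le (m : ℕ) {ℓ r s t Ω : ℝ} (hℓ : 0 < ℓ) (hr : 0 < r) (hs : 0 < s)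
    (hst : s < t) (ht1 : t ≤ 1) (hΩ : Ω ∈ Set.Icc (9/10 : ℝ) (10/9))
    {p : EuclideanSpace ℝ (Fin 3)} (hp : ℓ ≤ ‖p‖) :
    (‖p‖ ^ m)⁻¹ * (exp ((Ω ^ 2)⁻¹ * r * (t - s)) * kappa r (t - s) Ω p 0) *
        (exp ((Ω ^ 2)⁻¹ * r * s) * kappa r s Ω 0 p) ≤
      (ℓ ^ m)⁻¹ * (600 / ℓ ^ 4) ^ 2 * (2 * (1 + r ^ 2 * t ^ 2)) * exp (-(ℓ ^ 2 / 10 / t)) *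
        exp (-(‖p‖ ^ 2 / 10)) := by
  have ht : 0 < t := hs.trans hst
  have hts : 0 < t - s := sub_pos.2 hst
  have hΩ0 : 0 ≤ Ω := by linarith [hΩ.1]
  have hA := exp_mul_kappa_le_of_le_norm hℓ hr hts (by linarith) hΩ hp
  have hB := exp_mul_kappa_le_of_le_norm hℓ hr hs (by linarith) hΩ hp
  rw [kappa_comm r s Ω 0 p]
  have hk := kappa_nonneg hr hs.le hΩ0 p 0
  have hk' := kappa_nonneg hr hts.le hΩ0 p 0
  have hpoly : (1 + r * (t - s)) * (1 + r * s) ≤ 2 * (1 + r ^ 2 * t ^ 2) := by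
    calc (1 + r * (t - s)) * (1 + r * s) ≤ (1 + r * t) * (1 + r * t) := by
          gcongr
          linarith
      _ ≤ _ := by nlinarith [sq_nonneg (1 - r * t)]
  have hgauss : exp (-(‖p‖ ^ 2 / 10 / (t - s))) * exp (-(‖p‖ ^ 2 / 10 / s)) ≤
      exp (-(ℓ ^ 2 / 10 / t)) * exp (-(‖p‖ ^ 2 / 10)) := by
    rw [← exp_add, ← exp_add]
    apply exp_le_exp.2
    have h1 : ℓ ^ 2 / 10 / t ≤ ‖p‖ ^ 2 / 10 / (t - s) := by
      gcongr
      linarith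
    have h2 : ‖p‖ ^ 2 / 10 ≤ ‖p‖ ^ 2 / 10 / s :=
      le_div_self (by positivity) hs (by linarith)
    linarith
  calc _ ≤ (ℓ ^ m)⁻¹ * (600 / ℓ ^ 4 * (1 + r * (t - s)) * exp (-(‖p‖ ^ 2 / 10 / (t - s)))) *
        (600 / ℓ ^ 4 * (1 + r * s) * exp (-(‖p‖ ^ 2 / 10 / s))) := by
        gcongr
    _ = (ℓ ^ m)⁻¹ * (600 / ℓ ^ 4) ^ 2 * ((1 + r * (t - s)) * (1 + r * s)) *
        (exp (-(‖p‖ ^ 2 / 10 / (t - s))) * exp (-(‖p‖ ^ 2 / 10 / s))) := by ring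
    _ ≤ (ℓ ^ m)⁻¹ * (600 / ℓ ^ 4) ^ 2 * (2 * (1 + r ^ 2 * t ^ 2)) *
        (exp (-(ℓ ^ 2 / 10 / t)) * exp (-(‖p‖ ^ 2 / 10))) := by gcongr
    _ = _ := by ring

/-- The second inequality of (4.18) in the proof of Theorem 4.2. -/
theorem stmt10 (m : ℕ) (ℓ : ℝ) (hℓ : 0 < ℓ) : ∃ c : ℝ, 0 < c ∧
    ∀ (r t Ω : ℝ), 0 < r → 0 < t → t ≤ 1 → Ω ∈ Set.Icc (9/10 : ℝ) (10/9) →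
    (∫ s in (0:ℝ)..t, ∫ p in {p : EuclideanSpace ℝ (Fin 3) | ℓ ≤ ‖p‖},
        (‖p‖ ^ m)⁻¹ * (Real.exp ((Ω ^ 2)⁻¹ * r * (t - s)) * kappa r (t - s) Ω p 0) *
          (Real.exp ((Ω ^ 2)⁻¹ * r * s) * kappa r s Ω 0 p)) ≤
      c * (1 + r ^ 2 * t ^ 2) * Real.exp (-1 / (c * t)) := by
  set S := {p : EuclideanSpace ℝ (Fin 3) | ℓ ≤ ‖p‖} with hS
  have hSm : MeasurableSet S := measurableSet_le measurable_const measurable_norm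
  set I := ∫ p in S, exp (-(‖p‖ ^ 2 / 10)) with hI
  have hI0 : 0 ≤ I := integral_nonneg fun p => (exp_pos _).le
  set K := (ℓ ^ m)⁻¹ * (600 / ℓ ^ 4) ^ 2 * 2 * I with hK
  have hK0 : 0 ≤ K := by positivity
  refine ⟨K + 10 / ℓ ^ 2, by positivity, fun r t Ω hr ht ht1 hΩ => ?_⟩
  have hΩ0 : 0 ≤ Ω := by linarith [hΩ.1]
  have hinner : ∀ s ∈ Set.uIoc 0 t, ‖∫ p in S,
      (‖p‖ ^ m)⁻¹ * (Real.exp ((Ω ^ 2)⁻¹ * r * (t - s)) * kappa r (t - s) Ω p 0) *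
        (Real.exp ((Ω ^ 2)⁻¹ * r * s) * kappa r s Ω 0 p)‖ ≤
      K * (1 + r ^ 2 * t ^ 2) * exp (-(ℓ ^ 2 / 10 / t)) := by
    intro s hs
    rw [Set.uIoc_of_le ht.le] at hs
    rcases hs.2.eq_or_lt with rfl | hst
    · simp only [sub_self, kappa_zero_time, mul_zero, zero_mul, integral_zero, norm_zero]
      positivity
    have hpos : ∀ p : EuclideanSpace ℝ (Fin 3),
        0 ≤ (‖p‖ ^ m)⁻¹ * (Real.exp ((Ω ^ 2)⁻¹ * r * (t - s)) * kappa r (t - s) Ω p 0) *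
          (Real.exp ((Ω ^ 2)⁻¹ * r * s) * kappa r s Ω 0 p) := fun p => by
      have := kappa_nonneg hr hs.1.le hΩ0 0 p
      have := kappa_nonneg hr (sub_nonneg.2 hs.2) hΩ0 p 0
      positivity
    rw [norm_of_nonneg (integral_nonneg hpos)]
    calc _ ≤ ∫ p in S, (ℓ ^ m)⁻¹ * (600 / ℓ ^ 4) ^ 2 * (2 * (1 + r ^ 2 * t ^ 2)) *
          exp (-(ℓ ^ 2 / 10 / t)) * exp (-(‖p‖ ^ 2 / 10)) := by
          refine integral_mono_of_nonneg (.of_forall hpos)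
            (integrable_exp_neg_norm_sq.integrableOn.const_mul _) ?_
          filter_upwards [ae_restrict_mem hSm] with p hp
          exact kappa_convolution_le m hℓ hr hs.1 hst ht1 hΩ hp
      _ = K * (1 + r ^ 2 * t ^ 2) * exp (-(ℓ ^ 2 / 10 / t)) := by
          rw [integral_const_mul, ← hI, hK]
          ring
  calc _ ≤ K * (1 + r ^ 2 * t ^ 2) * exp (-(ℓ ^ 2 / 10 / t)) * |t - 0| :=
        (le_norm_self _).trans (intervalIntegral.norm_integral_le_of_norm_le_const hinner)
    _ ≤ K * (1 + r ^ 2 * t ^ 2) * exp (-(ℓ ^ 2 / 10 / t)) * 1 := by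
        gcongr
        rwa [sub_zero, abs_of_pos ht]
    _ = K * (1 + r ^ 2 * t ^ 2) * exp (-(1 / (10 / ℓ ^ 2 * t))) := by
        rw [mul_one]
        congr 3
        field_simp
    _ ≤ (K + 10 / ℓ ^ 2) * (1 + r ^ 2 * t ^ 2) * exp (-(1 / ((K + 10 / ℓ ^ 2) * t))) := by
        gcongr
        · linarith [show 0 < 10 / ℓ ^ 2 by positivity]
        · linarith
    _ = _ := by rw [neg_div]
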